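/- Let g be an orientation-preserving C¹ diffeomorphism of [0,1] such that log g' has bounded variation but g' is not absolutely continuous. Then left multiplication f ↦ g ∘ f on Diff₊^{1+BV}([0,1]) is not continuous with respect to the metric d(f,h) = sup|f−h| + ‖log f' − log h'‖_{BV}. -/

import Mathlib

open MeasureTheory Set Filter Topology intervalIntegral

noncomputable section

/-- An element of `Diff₊^{1+BV}([0,1])`: an orientation-preserving `C¹` diffeomorphism
of `[0,1]` whose derivative (equivalently, `log` of the derivative) has bounded
variation. -/
structure Diff1BV where
  toFun : ℝ → ℝ
  contDiff : ContDiffOn ℝ 1 toFun (Icc 0 1)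
  map0 : toFun 0 = 0
  map1 : toFun 1 = 1
  derivPos : ∀ x ∈ Icc (0:ℝ) 1, 0 < derivWithin toFun (Icc 0 1) x
  bv : BoundedVariationOn
    (fun x => Real.log (derivWithin toFun (Icc 0 1) x)) (Icc 0 1)

/-- The metric `d(f,h) = sup|f−h| + ‖log f' − log h'‖_{BV}` on `Diff₊^{1+BV}([0,1])`,
where `‖F‖_{BV} = |F(0)| + V(F)`. -/
def dBV (f h : Diff1BV) : ℝ :=
  (⨆ x : Icc (0:ℝ) 1, |f.toFun x - h.toFun x|) +
    (|Real.log (derivWithin f.toFun (Icc 0 1) 0)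
        - Real.log (derivWithin h.toFun (Icc 0 1) 0)| +
      (eVariationOn (fun x => Real.log (derivWithin f.toFun (Icc 0 1) x)
        - Real.log (derivWithin h.toFun (Icc 0 1) x)) (Icc 0 1)).toReal)

lemma eVariationOn_fun_sub_le (f g : ℝ → ℝ) (s : Set ℝ) :
    eVariationOn (fun x => f x - g x) s ≤ eVariationOn f s + eVariationOn g s := by
  refine iSup_le fun ⟨n, u, hu, us⟩ => ?_
  calc ∑ i ∈ Finset.range n, edist (f (u (i + 1)) - g (u (i + 1))) (f (u i) - g (u i))
      ≤ ∑ i ∈ Finset.range n,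
          (edist (f (u (i + 1))) (f (u i)) + edist (g (u (i + 1))) (g (u i))) :=
        Finset.sum_le_sum fun i _ => by
          simp only [edist_eq_enorm_sub]
          rw [sub_sub_sub_comm]
          exact enorm_sub_le
    _ ≤ eVariationOn f s + eVariationOn g s := by
        rw [Finset.sum_add_distrib]
        exact add_le_add (eVariationOn.sum_le hu us) (eVariationOn.sum_le hu us)

lemma BoundedVariationOn.fun_sub {f g : ℝ → ℝ} {s : Set ℝ} (hf : BoundedVariationOn f s)
    (hg : BoundedVariationOn g s) : BoundedVariationOn (fun x => f x - g x) s :=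
  ne_top_of_le_ne_top (ENNReal.add_ne_top.2 ⟨hf, hg⟩) (eVariationOn_fun_sub_le f g s)

lemma eVariationOn_fun_neg (f : ℝ → ℝ) (s : Set ℝ) :
    eVariationOn (fun x => -f x) s = eVariationOn f s := by
  simp [eVariationOn, edist_neg_neg]

lemma BoundedVariationOn.fun_add {f g : ℝ → ℝ} {s : Set ℝ} (hf : BoundedVariationOn f s)
    (hg : BoundedVariationOn g s) : BoundedVariationOn (fun x => f x + g x) s := by
  have hg' : BoundedVariationOn (fun x => -g x) s := by
    rwa [BoundedVariationOn, eVariationOn_fun_neg]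
  simpa using hf.fun_sub hg'

/-- The total variation of the singular part of a function of bounded variation is at most the
total variation of the function. -/
lemma BoundedVariationOn.abs_sub_integral_deriv_le {f : ℝ → ℝ} {a b : ℝ} (hab : a ≤ b)
    (hf : BoundedVariationOn f (Icc a b)) :
    |f b - f a - ∫ x in a..b, deriv f x| ≤ (eVariationOn f (Icc a b)).toReal := by
  obtain ⟨p, q, hp, hq, rfl, hpq⟩ :=
    hf.locallyBoundedVariationOn.exists_monotoneOn_sub_monotoneOn'
  have hV := hpq a (left_mem_Icc.2 hab) b (right_mem_Icc.2 hab)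
  rw [variationOnFromTo.eq_of_le _ _ hab, inter_self] at hV
  rw [← uIcc_of_le hab] at hp hq
  have hp0 : p a ≤ p b := hp left_mem_uIcc right_mem_uIcc hab
  have hq0 : q a ≤ q b := hq left_mem_uIcc right_mem_uIcc hab
  have hpi := hp.intervalIntegral_deriv_mem_uIcc
  have hqi := hq.intervalIntegral_deriv_mem_uIcc
  rw [uIcc_of_le (by linarith)] at hpi hqi
  have hI : ∫ x in a..b, deriv (p - q) x
      = (∫ x in a..b, deriv p x) - ∫ x in a..b, deriv q x := by
    rw [← intervalIntegral.integral_sub hp.intervalIntegrable_deriv hq.intervalIntegrable_deriv]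
    refine intervalIntegral.integral_congr_ae ?_
    have hp' := (hp.boundedVariationOn (C := max |p a| |p b|) fun x hx => ?_
      ).ae_differentiableAt_of_mem_uIcc
    have hq' := (hq.boundedVariationOn (C := max |q a| |q b|) fun x hx => ?_
      ).ae_differentiableAt_of_mem_uIcc
    · filter_upwards [hp', hq'] with x hpx hqx hx
      exact deriv_sub (hpx (uIoc_subset_uIcc hx)) (hqx (uIoc_subset_uIcc hx))
    · rw [uIcc_of_le hab] at hx
      exact abs_le_max_abs_abs (hq left_mem_uIcc (by rwa [uIcc_of_le hab]) hx.1)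
        (hq (by rwa [uIcc_of_le hab]) right_mem_uIcc hx.2)
    · rw [uIcc_of_le hab] at hx
      exact abs_le_max_abs_abs (hp left_mem_uIcc (by rwa [uIcc_of_le hab]) hx.1)
        (hp (by rwa [uIcc_of_le hab]) right_mem_uIcc hx.2)
  rw [hI, ← hV, Pi.sub_apply, Pi.sub_apply, abs_le]
  constructor <;> linarith [hpi.1, hpi.2, hqi.1, hqi.2]

/-- The fundamental theorem of calculus is closed under approximation in variation. -/
lemma BoundedVariationOn.integral_deriv_eq_sub_of_approx {f : ℝ → ℝ} {a b : ℝ} (hab : a ≤ b)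
    (hf : BoundedVariationOn f (Icc a b))
    (happ : ∀ η > 0, ∃ g, AbsolutelyContinuousOnInterval g a b ∧
      eVariationOn (fun x => f x - g x) (Icc a b) ≤ ENNReal.ofReal η) :
    ∫ x in a..b, deriv f x = f b - f a := by
  refine (eq_of_forall_dist_le fun η hη => ?_).symm
  rw [Real.dist_eq]
  obtain ⟨g, hg, hV⟩ := happ η hη
  have hgb := hg.boundedVariationOn
  have hd : BoundedVariationOn (fun x => f x - g x) (Icc a b) :=
    ne_top_of_le_ne_top ENNReal.ofReal_ne_top hV
  have hle := hd.abs_sub_integral_deriv_le hab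
  rw [← uIcc_of_le hab] at hf hd
  have hI : ∫ x in a..b, deriv (fun x => f x - g x) x
      = (∫ x in a..b, deriv f x) - ∫ x in a..b, deriv g x := by
    rw [← intervalIntegral.integral_sub hf.intervalIntegrable_deriv hgb.intervalIntegrable_deriv]
    refine intervalIntegral.integral_congr_ae ?_
    filter_upwards [hf.ae_differentiableAt_of_mem_uIcc, hgb.ae_differentiableAt_of_mem_uIcc]
      with x hfx hgx hx
    exact deriv_fun_sub (hfx (uIoc_subset_uIcc hx)) (hgx (uIoc_subset_uIcc hx))
  rw [hI, hg.integral_deriv_eq_sub] at hle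
  calc _ = |f b - g b - (f a - g a) - ((∫ x in a..b, deriv f x) - (g b - g a))| := by
        congr 1; ring
    _ ≤ _ := hle
    _ ≤ η := ENNReal.toReal_le_of_le_ofReal hη.le hV

lemma LipschitzOnWith.comp_absolutelyContinuousOnInterval {f F : ℝ → ℝ} {a b : ℝ} {K : NNReal}
    {t : Set ℝ} (hF : LipschitzOnWith K F t) (hf : AbsolutelyContinuousOnInterval f a b)
    (hft : MapsTo f (uIcc a b) t) : AbsolutelyContinuousOnInterval (F ∘ f) a b := by
  have h0 : Tendsto (fun E : ℕ × (ℕ → ℝ × ℝ) =>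
      (K : ℝ) * ∑ i ∈ Finset.range E.1, dist (f (E.2 i).1) (f (E.2 i).2))
      (AbsolutelyContinuousOnInterval.totalLengthFilter ⊓
        𝓟 (AbsolutelyContinuousOnInterval.disjWithin a b)) (𝓝 0) := by
    simpa using Tendsto.const_mul (K : ℝ) hf
  refine squeeze_zero' (Eventually.of_forall fun E => Finset.sum_nonneg fun _ _ => dist_nonneg)
    ?_ h0
  filter_upwards [mem_inf_of_right (mem_principal_self _)] with E hE
  rw [Finset.mul_sum]
  exact Finset.sum_le_sum fun i hi =>
    hF.dist_le_mul _ (hft (hE.1 i hi).1) _ (hft (hE.1 i hi).2)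

/-- A function satisfying the fundamental theorem of calculus on all compact subintervals of
`(0, 1)`, and continuous and of bounded variation on `[0, 1]`, is an integral on `[0, 1]`. -/
lemma BoundedVariationOn.eq_add_integral_deriv {f : ℝ → ℝ}
    (hf : BoundedVariationOn f (Icc 0 1)) (hc : ContinuousOn f (Icc 0 1))
    (hint : ∀ a b, 0 < a → a ≤ b → b < 1 → ∫ x in a..b, deriv f x = f b - f a) :
    ∀ x ∈ Icc (0 : ℝ) 1, f x = f 0 + ∫ t in (0 : ℝ)..x, deriv f t := by
  have hI : IntervalIntegrable (deriv f) volume 0 1 :=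
    BoundedVariationOn.intervalIntegrable_deriv (by rwa [uIcc_of_le zero_le_one])
  have hI' : ∀ x ∈ Icc (0 : ℝ) 1, IntervalIntegrable (deriv f) volume 0 x := fun x hx =>
    hI.mono_set (by rw [uIcc_of_le hx.1, uIcc_of_le zero_le_one]; exact Icc_subset_Icc_right hx.2)
  set u : ℝ → ℝ := fun x => f x - ∫ t in (0 : ℝ)..x, deriv f t with hu
  have huc : ContinuousOn u (Icc 0 1) := by
    refine hc.sub ?_
    have := intervalIntegral.continuousOn_primitive_interval' hI left_mem_uIcc
    rwa [uIcc_of_le zero_le_one] at this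
  have hconst : ∀ x ∈ Ioo (0 : ℝ) 1, u x = u (1 / 2) := by
    have key : ∀ a b, 0 < a → a ≤ b → b < 1 → u a = u b := fun a b ha hab hb => by
      have h1 := hint a b ha hab hb
      have h2 := intervalIntegral.integral_interval_sub_left (hI' b ⟨by linarith, hb.le⟩)
        (hI' a ⟨ha.le, by linarith⟩)
      simp only [hu]
      linarith
    intro x hx
    rcases le_total x (1 / 2) with h | h
    · exact key _ _ hx.1 h (by norm_num)
    · exact (key _ _ (by norm_num) h hx.2).symm
  have hcl : EqOn u (fun _ => u (1 / 2)) (Icc 0 1) := by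
    refine EqOn.of_subset_closure (s := Ioo 0 1) hconst huc continuousOn_const
      Ioo_subset_Icc_self ?_
    rw [closure_Ioo zero_ne_one]
  intro x hx
  have h := (hcl hx).trans (hcl (left_mem_Icc.2 zero_le_one)).symm
  simp only [hu, intervalIntegral.integral_same] at h
  linarith

/-- The quadratic perturbation `x ↦ x + h x (1 - x)` of the identity, which for `|h| < 1` is a
diffeomorphism of `[0, 1]`. -/
def quadShift (h x : ℝ) : ℝ := x + h * (x * (1 - x))

lemma quadShift_mem_Icc {h x : ℝ} (hh : h ∈ Icc (0 : ℝ) 1) (hx : x ∈ Icc (0 : ℝ) 1) :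
    quadShift h x ∈ Icc (0 : ℝ) 1 := by
  obtain ⟨h0, h1⟩ := hh
  obtain ⟨x0, x1⟩ := hx
  have := mul_nonneg x0 (sub_nonneg.2 x1)
  constructor <;> simp only [quadShift] <;> nlinarith

lemma hasDerivAt_quadShift (h x : ℝ) : HasDerivAt (quadShift h) (1 + h * (1 - 2 * x)) x := by
  have := (hasDerivAt_id x).add
    (((hasDerivAt_id x).mul ((hasDerivAt_id x).const_sub 1)).const_mul h)
  convert! this using 1
  simp only [id]
  ring

/-- The average of `φ` along the perturbations `quadShift t`, `0 ≤ t ≤ ε`. -/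
def quadAverage (φ : ℝ → ℝ) (ε x : ℝ) : ℝ := ε⁻¹ * ∫ t in (0 : ℝ)..ε, φ (quadShift t x)

lemma quadAverage_eq {φ : ℝ → ℝ} (hφ : Continuous φ) (ε : ℝ) {x : ℝ} (hx : x * (1 - x) ≠ 0) :
    quadAverage φ ε x = ε⁻¹ * ((x * (1 - x))⁻¹ *
      ((∫ t in (0 : ℝ)..quadShift ε x, φ t) - ∫ t in (0 : ℝ)..x, φ t)) := by
  rw [quadAverage, intervalIntegral.integral_interval_sub_left (hφ.intervalIntegrable _ _)
    (hφ.intervalIntegrable _ _)]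
  have h := intervalIntegral.integral_comp_add_mul (a := 0) (b := ε) φ hx x
  simp only [quadShift, mul_zero, add_zero, smul_eq_mul, mul_comm _ (x * (1 - x))] at h ⊢
  rw [h]

lemma absolutelyContinuousOnInterval_quadAverage {φ : ℝ → ℝ} (hφ : Continuous φ) (ε : ℝ)
    {a b : ℝ} (ha : 0 < a) (hab : a ≤ b) (hb : b < 1) :
    AbsolutelyContinuousOnInterval (quadAverage φ ε) a b := by
  have hne : ∀ x ∈ uIcc a b, x * (1 - x) ≠ 0 := by
    intro x hx
    rw [uIcc_of_le hab] at hx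
    exact (mul_pos (by linarith [hx.1]) (by linarith [hx.2])).ne'
  have hprim : ContDiff ℝ 1 fun x => ∫ t in (0 : ℝ)..x, φ t := by
    rw [contDiff_one_iff_deriv]
    refine ⟨fun x => (hφ.integral_hasStrictDerivAt 0 x).hasDerivAt.differentiableAt, ?_⟩
    have : deriv (fun x => ∫ t in (0 : ℝ)..x, φ t) = φ := funext fun x => hφ.deriv_integral φ 0 x
    rwa [this]
  have hq : ContDiff ℝ 1 (quadShift ε) := by
    unfold quadShift
    fun_prop
  refine ContDiffOn.absolutelyContinuousOnInterval
    (ContDiffOn.congr ?_ fun x hx => quadAverage_eq hφ ε (hne x hx))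
  refine contDiffOn_const.mul (ContDiffOn.mul (ContDiffOn.inv ?_ hne) ?_)
  · fun_prop
  · exact ((hprim.comp hq).sub hprim).contDiffOn

lemma eVariationOn_sub_quadAverage_le {φ : ℝ → ℝ} (hφ : Continuous φ) {ε η : ℝ} (hε : 0 < ε)
    (hη : 0 ≤ η) {s : Set ℝ}
    (hV : ∀ t ∈ Ioc 0 ε, eVariationOn (fun x => φ (quadShift t x) - φ x) s ≤ ENNReal.ofReal η) :
    eVariationOn (fun x => φ x - quadAverage φ ε x) s ≤ ENNReal.ofReal η := by
  refine iSup_le fun ⟨n, u, hu, us⟩ => ?_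
  have hcont : ∀ x, Continuous fun t => φ (quadShift t x) - φ x := fun x =>
    (hφ.comp (by unfold quadShift; fun_prop)).sub continuous_const
  have hrep : ∀ x, φ x - quadAverage φ ε x
      = -(ε⁻¹ * ∫ t in (0 : ℝ)..ε, (φ (quadShift t x) - φ x)) := fun x => by
    have hc : Continuous fun t => φ (quadShift t x) := hφ.comp (by unfold quadShift; fun_prop)
    rw [intervalIntegral.integral_sub (hc.intervalIntegrable _ _)
      (continuous_const.intervalIntegrable _ _), intervalIntegral.integral_const, quadAverage,
      smul_eq_mul]
    field_simp
    ring
  have hdist : ∀ x y, dist (φ x - quadAverage φ ε x) (φ y - quadAverage φ ε y)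
      ≤ ε⁻¹ * ∫ t in (0 : ℝ)..ε,
        dist (φ (quadShift t x) - φ x) (φ (quadShift t y) - φ y) := fun x y => by
    rw [hrep, hrep, dist_neg_neg, Real.dist_eq, ← mul_sub,
      ← intervalIntegral.integral_sub ((hcont x).intervalIntegrable _ _)
      ((hcont y).intervalIntegrable _ _), abs_mul, abs_of_pos (inv_pos.2 hε)]
    gcongr
    exact intervalIntegral.abs_integral_le_integral_abs hε.le
  have hci : ∀ i, Continuous fun t => dist (φ (quadShift t (u (i + 1))) - φ (u (i + 1)))
      (φ (quadShift t (u i)) - φ (u i)) := fun i => (hcont _).dist (hcont _)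
  simp only [edist_dist]
  rw [← ENNReal.ofReal_sum_of_nonneg fun _ _ => dist_nonneg]
  refine ENNReal.ofReal_le_ofReal ?_
  calc _ ≤ ∑ i ∈ Finset.range n, ε⁻¹ * ∫ t in (0 : ℝ)..ε,
        dist (φ (quadShift t (u (i + 1))) - φ (u (i + 1))) (φ (quadShift t (u i)) - φ (u i)) :=
        Finset.sum_le_sum fun i _ => hdist _ _
    _ = ε⁻¹ * ∫ t in (0 : ℝ)..ε, ∑ i ∈ Finset.range n,
        dist (φ (quadShift t (u (i + 1))) - φ (u (i + 1))) (φ (quadShift t (u i)) - φ (u i)) := by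
        rw [← Finset.mul_sum, intervalIntegral.integral_finsetSum]
        exact fun i _ => (hci i).intervalIntegrable _ _
    _ ≤ ε⁻¹ * ∫ t in (0 : ℝ)..ε, η := by
        gcongr
        refine intervalIntegral.integral_mono_on_of_le_Ioo hε.le
          ((continuous_finsetSum _ fun i _ => hci i).intervalIntegrable _ _)
          (continuous_const.intervalIntegrable _ _) fun t ht => ?_
        have h := (eVariationOn.sum_le (n := n) hu us).trans (hV t (Ioo_subset_Ioc_self ht))
        simp only [edist_dist] at h
        rwa [← ENNReal.ofReal_sum_of_nonneg fun _ _ => dist_nonneg,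
          ENNReal.ofReal_le_ofReal_iff hη] at h
    _ = η := by
        rw [intervalIntegral.integral_const, smul_eq_mul, sub_zero, inv_mul_cancel_left₀ hε.ne']

/-- A continuous function of bounded variation on `[0, 1]` that is continuous in variation along
the perturbations `quadShift t` of the identity is the integral of its derivative. -/
lemma BoundedVariationOn.eq_add_integral_deriv_of_quadShift {φ : ℝ → ℝ}
    (hbv : BoundedVariationOn φ (Icc 0 1)) (hc : ContinuousOn φ (Icc 0 1))
    (hV : ∀ η > 0, ∃ δ > 0, ∀ t ∈ Ioo 0 δ,
      eVariationOn (fun x => φ (quadShift t x) - φ x) (Icc 0 1) ≤ ENNReal.ofReal η) :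
    ∀ x ∈ Icc (0 : ℝ) 1, φ x = φ 0 + ∫ t in (0 : ℝ)..x, deriv φ t := by
  refine hbv.eq_add_integral_deriv hc fun a b ha hab hb => ?_
  have hsub : Icc a b ⊆ Icc 0 1 := Icc_subset_Icc ha.le hb.le
  refine (hbv.mono hsub).integral_deriv_eq_sub_of_approx hab fun η hη => ?_
  obtain ⟨δ, hδ, hVδ⟩ := hV η hη
  set ψ : ℝ → ℝ := IccExtend (zero_le_one' ℝ) ((Icc (0 : ℝ) 1).domRestrict φ) with hψ
  have hψc : Continuous ψ := hc.domRestrict.Icc_extend'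
  have hψφ : EqOn ψ φ (Icc 0 1) := fun x hx => by rw [hψ, IccExtend_of_mem _ _ hx]; rfl
  set ε := min (δ / 2) 1 with hε
  have hε0 : 0 < ε := by positivity
  refine ⟨quadAverage ψ ε, absolutelyContinuousOnInterval_quadAverage hψc ε ha hab hb, ?_⟩
  rw [eVariationOn.congr (g := fun x => ψ x - quadAverage ψ ε x) fun x hx => by
    simp only [hψφ (hsub hx)]]
  refine (eVariationOn.mono _ hsub).trans
    (eVariationOn_sub_quadAverage_le hψc hε0 hη.le fun t ht => ?_)
  rw [eVariationOn.congr (g := fun x => φ (quadShift t x) - φ x) fun x hx => by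
    simp only [hψφ hx, hψφ (quadShift_mem_Icc ⟨ht.1.le, ht.2.trans (min_le_right _ _)⟩ hx)]]
  exact hVδ t ⟨ht.1, by linarith [ht.2, min_le_left (δ / 2) 1]⟩

namespace Diff1BV

lemma differentiableOn (f : Diff1BV) : DifferentiableOn ℝ f.toFun (Icc 0 1) :=
  f.contDiff.differentiableOn one_ne_zero

lemma hasDerivWithinAt (f : Diff1BV) {x : ℝ} (hx : x ∈ Icc (0 : ℝ) 1) :
    HasDerivWithinAt f.toFun (derivWithin f.toFun (Icc 0 1) x) (Icc 0 1) x :=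
  (f.differentiableOn x hx).hasDerivWithinAt

lemma continuousOn_derivWithin (f : Diff1BV) :
    ContinuousOn (derivWithin f.toFun (Icc 0 1)) (Icc 0 1) :=
  f.contDiff.continuousOn_derivWithin (uniqueDiffOn_Icc zero_lt_one) le_rfl

lemma continuousOn_log_derivWithin (f : Diff1BV) :
    ContinuousOn (fun x => Real.log (derivWithin f.toFun (Icc 0 1) x)) (Icc 0 1) :=
  f.continuousOn_derivWithin.log fun x hx => (f.derivPos x hx).ne'

lemma monotoneOn (f : Diff1BV) : MonotoneOn f.toFun (Icc 0 1) := by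
  refine monotoneOn_of_deriv_nonneg (convex_Icc 0 1) f.contDiff.continuousOn
    (f.differentiableOn.mono interior_subset) fun x hx => ?_
  rw [← derivWithin_of_mem_nhds (mem_interior_iff_mem_nhds.1 hx)]
  exact (f.derivPos x (interior_subset hx)).le

lemma mapsTo (f : Diff1BV) : MapsTo f.toFun (Icc 0 1) (Icc 0 1) := fun _ hx =>
  ⟨f.map0.symm.trans_le (f.monotoneOn (left_mem_Icc.2 zero_le_one) hx hx.1),
    (f.monotoneOn hx (right_mem_Icc.2 zero_le_one) hx.2).trans_eq f.map1⟩

lemma derivWithin_comp (g f : Diff1BV) {x : ℝ} (hx : x ∈ Icc (0 : ℝ) 1) :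
    derivWithin (g.toFun ∘ f.toFun) (Icc 0 1) x
      = derivWithin g.toFun (Icc 0 1) (f.toFun x) * derivWithin f.toFun (Icc 0 1) x :=
  ((g.hasDerivWithinAt (f.mapsTo hx)).comp x (f.hasDerivWithinAt hx) f.mapsTo).derivWithin
    (uniqueDiffOn_Icc zero_lt_one x hx)

lemma log_derivWithin_comp (g f : Diff1BV) {x : ℝ} (hx : x ∈ Icc (0 : ℝ) 1) :
    Real.log (derivWithin (g.toFun ∘ f.toFun) (Icc 0 1) x)
      = Real.log (derivWithin g.toFun (Icc 0 1) (f.toFun x))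
        + Real.log (derivWithin f.toFun (Icc 0 1) x) := by
  rw [derivWithin_comp g f hx,
    Real.log_mul (g.derivPos _ (f.mapsTo hx)).ne' (f.derivPos x hx).ne']

/-- Composition in `Diff₊^{1+BV}([0,1])`. -/
def comp (g f : Diff1BV) : Diff1BV where
  toFun := g.toFun ∘ f.toFun
  contDiff := g.contDiff.comp f.contDiff f.mapsTo
  map0 := by simp [f.map0, g.map0]
  map1 := by simp [f.map1, g.map1]
  derivPos x hx := by
    rw [derivWithin_comp g f hx]
    exact mul_pos (g.derivPos _ (f.mapsTo hx)) (f.derivPos x hx)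
  bv := by
    rw [BoundedVariationOn, eVariationOn.congr fun _ hx => log_derivWithin_comp g f hx]
    refine BoundedVariationOn.fun_add ?_ f.bv
    exact ne_top_of_le_ne_top g.bv
      (eVariationOn.comp_le_of_monotoneOn _ f.toFun f.monotoneOn f.mapsTo)

lemma derivWithin_quadShift (h : ℝ) {x : ℝ} (hx : x ∈ Icc (0 : ℝ) 1) :
    derivWithin (quadShift h) (Icc 0 1) x = 1 + h * (1 - 2 * x) :=
  (hasDerivAt_quadShift h x).hasDerivWithinAt.derivWithin (uniqueDiffOn_Icc zero_lt_one x hx)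

lemma one_add_mul_pos {h x : ℝ} (hh : h ∈ Ico (0 : ℝ) 1) (hx : x ∈ Icc (0 : ℝ) 1) :
    0 < 1 + h * (1 - 2 * x) := by
  nlinarith [hh.1, hh.2, hx.1, hx.2, mul_nonneg hh.1 (sub_nonneg.2 hx.2)]

lemma eVariationOn_log_quadShift {h : ℝ} (hh : h ∈ Ico (0 : ℝ) 1) :
    eVariationOn (fun x => Real.log (1 + h * (1 - 2 * x))) (Icc 0 1)
      = ENNReal.ofReal (Real.log (1 + h) - Real.log (1 - h)) := by
  have hmono : MonotoneOn (fun x => -Real.log (1 + h * (1 - 2 * x))) (Icc 0 1) :=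
    fun x hx y hy hxy => neg_le_neg <| Real.log_le_log (one_add_mul_pos hh hy) <| by
      have := mul_le_mul_of_nonneg_left hxy hh.1
      linarith
  have h01 : (0 : ℝ) ≤ 1 := zero_le_one
  rw [← eVariationOn_fun_neg, ← inter_self (Icc (0 : ℝ) 1),
    hmono.eVariationOn_eq (left_mem_Icc.2 h01) (right_mem_Icc.2 h01)]
  congr 1
  norm_num
  ring_nf

/-- `quadShift h` as an element of `Diff₊^{1+BV}([0,1])`. -/
def quad (h : ℝ) (hh : h ∈ Ico (0 : ℝ) 1) : Diff1BV where
  toFun := quadShift h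
  contDiff := by
    unfold quadShift
    fun_prop
  map0 := by simp [quadShift]
  map1 := by simp [quadShift]
  derivPos _ hx := by
    rw [derivWithin_quadShift h hx]
    exact one_add_mul_pos hh hx
  bv := by
    rw [BoundedVariationOn, eVariationOn.congr fun x hx => by rw [derivWithin_quadShift h hx],
      eVariationOn_log_quadShift hh]
    exact ENNReal.ofReal_ne_top

lemma dBV_nonneg (f h : Diff1BV) : 0 ≤ dBV f h := by
  unfold dBV
  have : 0 ≤ ⨆ x : Icc (0 : ℝ) 1, |f.toFun x - h.toFun x| := Real.iSup_nonneg fun _ => abs_nonneg _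
  positivity

lemma eVariationOn_le_dBV (f h : Diff1BV) :
    (eVariationOn (fun x => Real.log (derivWithin f.toFun (Icc 0 1) x)
        - Real.log (derivWithin h.toFun (Icc 0 1) x)) (Icc 0 1)).toReal ≤ dBV f h := by
  unfold dBV
  have : 0 ≤ ⨆ x : Icc (0 : ℝ) 1, |f.toFun x - h.toFun x| := Real.iSup_nonneg fun _ => abs_nonneg _
  linarith [abs_nonneg (Real.log (derivWithin f.toFun (Icc 0 1) 0)
        - Real.log (derivWithin h.toFun (Icc 0 1) 0))]

lemma dBV_quad_le {h : ℝ} (hh : h ∈ Ico (0 : ℝ) 1) :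
    dBV (quad h hh) (quad 0 (left_mem_Ico.2 zero_lt_one))
      ≤ h + (Real.log (1 + h) + (Real.log (1 + h) - Real.log (1 - h))) := by
  have h0 : (0 : ℝ) ∈ Icc (0 : ℝ) 1 := left_mem_Icc.2 zero_le_one
  have hlog : 0 ≤ Real.log (1 + h) := Real.log_nonneg (by linarith [hh.1])
  have hlog' : Real.log (1 - h) ≤ 0 := Real.log_nonpos (by linarith [hh.2]) (by linarith [hh.1])
  unfold dBV
  refine add_le_add (Real.iSup_le (fun x => ?_) hh.1) (add_le_add (le_of_eq ?_) (le_of_eq ?_))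
  · obtain ⟨x, hx0, hx1⟩ := x
    have hx := mul_nonneg hx0 (sub_nonneg.2 hx1)
    have : (quad h hh).toFun x - (quad 0 (left_mem_Ico.2 zero_lt_one)).toFun x
        = h * (x * (1 - x)) := by
      simp [quad, quadShift]
    rw [this, abs_of_nonneg (mul_nonneg hh.1 hx)]
    nlinarith [hh.1, mul_nonneg hh.1 (sq_nonneg x), mul_nonneg hh.1 (sub_nonneg.2 hx1)]
  · simp only [quad]
    rw [derivWithin_quadShift h h0, derivWithin_quadShift 0 h0]
    simpa using hlog
  · rw [eVariationOn.congr (g := fun x => Real.log (1 + h * (1 - 2 * x))) fun x hx => by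
      simp only [quad]
      rw [derivWithin_quadShift h hx, derivWithin_quadShift 0 hx]
      simp, eVariationOn_log_quadShift hh, ENNReal.toReal_ofReal (by linarith)]

/-- The variation of the increment of `log g'` along `quadShift h` is controlled by the distances
between the perturbed and unperturbed diffeomorphisms and their images under `g`. -/
lemma eVariationOn_log_derivWithin_quadShift_le (g : Diff1BV) {h : ℝ} (hh : h ∈ Ico (0 : ℝ) 1) :
    eVariationOn (fun x => Real.log (derivWithin g.toFun (Icc 0 1) (quadShift h x))
        - Real.log (derivWithin g.toFun (Icc 0 1) x)) (Icc 0 1)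
      ≤ ENNReal.ofReal (dBV (g.comp (quad h hh)) (g.comp (quad 0 (left_mem_Ico.2 zero_lt_one)))
        + dBV (quad h hh) (quad 0 (left_mem_Ico.2 zero_lt_one))) := by
  set f := quad h hh
  set f₀ := quad 0 (left_mem_Ico.2 zero_lt_one) with hf₀
  have key : ∀ p q : Diff1BV, eVariationOn (fun x => Real.log (derivWithin p.toFun (Icc 0 1) x)
        - Real.log (derivWithin q.toFun (Icc 0 1) x)) (Icc 0 1) ≤ ENNReal.ofReal (dBV p q) :=
    fun p q => ENNReal.le_ofReal_iff_toReal_le (p.bv.fun_sub q.bv) (dBV_nonneg p q) |>.2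
      (eVariationOn_le_dBV p q)
  rw [ENNReal.ofReal_add (dBV_nonneg _ _) (dBV_nonneg _ _)]
  refine le_trans (le_of_eq ?_) ((eVariationOn_fun_sub_le _ _ _).trans
    (add_le_add (key (g.comp f) (g.comp f₀)) (key f f₀)))
  refine eVariationOn.congr fun x hx => ?_
  have h1 := log_derivWithin_comp g f hx
  have h2 := log_derivWithin_comp g f₀ hx
  have h3 : f₀.toFun x = x := by simp [hf₀, quad, quadShift]
  have h4 : f.toFun x = quadShift h x := rfl
  rw [h3] at h2
  rw [h4] at h1
  simp only [comp]
  linarith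

/-- If the increments of `log g'` along `quadShift t` tend to zero in variation as `t → 0⁺`, then
`g'` is the integral of its derivative. -/
lemma exists_derivWithin_eq_add_integral (g : Diff1BV)
    (hV : ∀ η > 0, ∃ δ > 0, ∀ t ∈ Ioo 0 δ,
      eVariationOn (fun x => Real.log (derivWithin g.toFun (Icc 0 1) (quadShift t x))
        - Real.log (derivWithin g.toFun (Icc 0 1) x)) (Icc 0 1) ≤ ENNReal.ofReal η) :
    ∃ h : ℝ → ℝ, IntegrableOn h (Icc 0 1) ∧ ∀ x ∈ Icc (0:ℝ) 1,
      derivWithin g.toFun (Icc 0 1) x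
        = derivWithin g.toFun (Icc 0 1) 0 + ∫ t in (0:ℝ)..x, h t := by
  set φ : ℝ → ℝ := fun x => Real.log (derivWithin g.toFun (Icc 0 1) x)
  have hφbv : BoundedVariationOn φ (Icc 0 1) := g.bv
  have hφc : ContinuousOn φ (Icc 0 1) := g.continuousOn_log_derivWithin
  have hrep := hφbv.eq_add_integral_deriv_of_quadShift hφc hV
  set Φ : ℝ → ℝ := fun x => φ 0 + ∫ t in (0 : ℝ)..x, deriv φ t
  have h01 : uIcc (0 : ℝ) 1 = Icc 0 1 := uIcc_of_le zero_le_one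
  have hint : IntervalIntegrable (deriv φ) volume 0 1 :=
    BoundedVariationOn.intervalIntegrable_deriv (by rwa [h01])
  have hΦac : AbsolutelyContinuousOnInterval Φ 0 1 :=
    (contDiffOn_const (c := φ 0)).absolutelyContinuousOnInterval.fun_add
      (hint.absolutelyContinuousOnInterval_intervalIntegral left_mem_uIcc)
  obtain ⟨C, hC⟩ := hΦac.exists_bound
  obtain ⟨K, hK⟩ := (Real.contDiff_exp (n := 1)).contDiffOn.exists_lipschitzOnWith one_ne_zero
    (convex_Icc (-C) C) isCompact_Icc
  have hE := hK.comp_absolutelyContinuousOnInterval hΦac fun x hx => abs_le.1 (hC x hx)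
  have hEq : EqOn (Real.exp ∘ Φ) (derivWithin g.toFun (Icc 0 1)) (Icc 0 1) := fun x hx => by
    rw [Function.comp_apply, ← show φ x = Φ x from hrep x hx]
    exact Real.exp_log (g.derivPos x hx)
  refine ⟨deriv (Real.exp ∘ Φ), ?_, fun x hx => ?_⟩
  · exact (intervalIntegrable_iff_integrableOn_Icc_of_le zero_le_one).1 hE.intervalIntegrable_deriv
  · have hsub : uIcc 0 x ⊆ uIcc (0 : ℝ) 1 := by
      rw [h01, uIcc_of_le hx.1]
      exact Icc_subset_Icc_right hx.2
    rw [(hE.mono hsub).integral_deriv_eq_sub, hEq hx, hEq (left_mem_Icc.2 zero_le_one)]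
    ring

end Diff1BV

/-- If `g ∈ Diff₊^{1+BV}([0,1])` but `g'` is not absolutely continuous, then left
multiplication `f ↦ g ∘ f` is not continuous for the metric `dBV`: there is a sequence
`fₙ → f₀` in `dBV` whose composites `g ∘ fₙ` do not converge to `g ∘ f₀` in `dBV`. -/
theorem left_multiplication_not_continuous
    (g : Diff1BV)
    (hnotAC : ¬ ∃ h : ℝ → ℝ, IntegrableOn h (Icc 0 1) ∧ ∀ x ∈ Icc (0:ℝ) 1,
      derivWithin g.toFun (Icc 0 1) x
        = derivWithin g.toFun (Icc 0 1) 0 + ∫ t in (0:ℝ)..x, h t) :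
    ∃ (f : ℕ → Diff1BV) (f₀ : Diff1BV) (c : ℕ → Diff1BV) (c₀ : Diff1BV),
      (∀ n, (c n).toFun = g.toFun ∘ (f n).toFun) ∧
      c₀.toFun = g.toFun ∘ f₀.toFun ∧
      Tendsto (fun n => dBV (f n) f₀) atTop (𝓝 0) ∧
      ¬ Tendsto (fun n => dBV (c n) c₀) atTop (𝓝 0) := by
  obtain ⟨η, hη, hfar⟩ : ∃ η > 0, ∀ δ > 0, ∃ t ∈ Ioo 0 δ, ENNReal.ofReal η <
      eVariationOn (fun x => Real.log (derivWithin g.toFun (Icc 0 1) (quadShift t x))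
        - Real.log (derivWithin g.toFun (Icc 0 1) x)) (Icc 0 1) := by
    by_contra! H
    exact hnotAC (g.exists_derivWithin_eq_add_integral H)
  choose t ht hVt using fun n : ℕ => hfar (1 / ((n : ℝ) + 1)) Nat.one_div_pos_of_nat
  have htI : ∀ n, t n ∈ Ico (0 : ℝ) 1 := fun n =>
    ⟨(ht n).1.le, (ht n).2.trans_le (div_le_one_of_le₀ (by simp) (by positivity))⟩
  have ht0 : Tendsto t atTop (𝓝 0) :=
    squeeze_zero (fun n => (ht n).1.le) (fun n => (ht n).2.le)
      tendsto_one_div_add_atTop_nhds_zero_nat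
  set f : ℕ → Diff1BV := fun n => Diff1BV.quad (t n) (htI n)
  set f₀ : Diff1BV := Diff1BV.quad 0 (left_mem_Ico.2 zero_lt_one)
  have hlim : Tendsto (fun n => dBV (f n) f₀) atTop (𝓝 0) := by
    refine squeeze_zero (fun n => Diff1BV.dBV_nonneg _ _)
      (fun n => Diff1BV.dBV_quad_le (htI n)) ?_
    have hcont : ContinuousAt
        (fun h : ℝ => h + (Real.log (1 + h) + (Real.log (1 + h) - Real.log (1 - h)))) 0 := by
      fun_prop (disch := norm_num)
    simpa [Function.comp_def] using hcont.tendsto.comp ht0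
  refine ⟨f, f₀, fun n => g.comp (f n), g.comp f₀, fun n => rfl, rfl, hlim, fun hcomp => ?_⟩
  refine hη.not_ge (ge_of_tendsto' (by simpa using hcomp.add hlim) fun n => ?_)
  by_contra! hlt
  exact ((hVt n).trans_le ((g.eVariationOn_log_derivWithin_quadShift_le (htI n)).trans
    (ENNReal.ofReal_le_ofReal hlt.le))).false
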